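/- arXiv:1608.07472 — 3 statements merged into one kernel-verified Lean document; each statement's English description precedes it below -/
import Mathlib

section
/- Let g be a dg Lie algebra over k and h ⊆ g a dg Lie ideal, i.e. a family of subspaces h^i ⊆ g^i with d(h^i) ⊆ h^{i+1} and [g^i, h^j] ⊆ h^{i+j}. Define the cone C with components C^n := h^{n+1} × g^n, differential d_C(x,y) := (−d_h x, x + d_g y), and bracket [(x,y),(x′,y′)] := ((−1)^p [y,x′] + [x,y′], [y,y′]) for x,x′ ∈ h, y ∈ g^p, y′ ∈ g. Then C = (C^•, d_C, [·,·]) is a dg Lie algebra: d_C ∘ d_C = 0, and the bracket satisfies graded skew-symmetry, the graded Jacobi identity, and the graded Leibniz rule with respect to the total grading of C. -/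
/-- A differential graded Lie algebra over `k`, presented as an internally ℤ-graded
`k`-vector space `V`: a family of subspaces `grading i ⊆ V`, a differential `d` of degree `+1`
with `d ∘ d = 0`, and a bracket of degree `0` satisfying graded skew-symmetry, the graded
Jacobi identity and the graded Leibniz rule on homogeneous elements. -/
structure DGLieAlgebra (k : Type*) [Field k] (V : Type*) [AddCommGroup V] [Module k V] where
  grading : ℤ → Submodule k V
  d : V →ₗ[k] V
  bracket : V →ₗ[k] V →ₗ[k] V
  d_d : ∀ x : V, d (d x) = 0
  d_mem : ∀ (i : ℤ), ∀ x ∈ grading i, d x ∈ grading (i + 1)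
  bracket_mem : ∀ (i j : ℤ), ∀ x ∈ grading i, ∀ y ∈ grading j, bracket x y ∈ grading (i + j)
  skew : ∀ (i j : ℤ), ∀ x ∈ grading i, ∀ y ∈ grading j,
    bracket x y = -(((-1 : k) ^ (i * j)) • bracket y x)
  jacobi : ∀ (i j : ℤ), ∀ x ∈ grading i, ∀ y ∈ grading j, ∀ z : V,
    bracket x (bracket y z) =
      bracket (bracket x y) z + ((-1 : k) ^ (i * j)) • bracket y (bracket x z)
  leibniz : ∀ (i : ℤ), ∀ x ∈ grading i, ∀ y : V,
    d (bracket x y) = bracket (d x) y + ((-1 : k) ^ i) • bracket x (d y)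

theorem exists_sign_map {k V : Type*} [Field k] [AddCommGroup V] [Module k V]
    (G : ℤ → Submodule k V) (hG : DirectSum.IsInternal fun i : ℤ => G i) :
    ∃ s : V →ₗ[k] V, ∀ p : ℤ, ∀ y ∈ G p, s y = ((-1 : k) ^ p) • y := by
  let e := LinearEquiv.ofBijective (DirectSum.coeLinearMap G) hG
  refine ⟨(DirectSum.toModule k ℤ V (fun i => ((-1 : k) ^ i) • (G i).subtype)) ∘ₗ
    e.symm.toLinearMap, ?_⟩
  intro p y hy
  have he : e.symm y = DirectSum.lof k ℤ (fun i => G i) p ⟨y, hy⟩ := by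
    rw [LinearEquiv.symm_apply_eq]
    exact (DirectSum.coeLinearMap_lof G p ⟨y, hy⟩).symm
  simp [he]

theorem sign_cases {k : Type*} [Field k] (i : ℤ) : (-1 : k) ^ i = 1 ∨ (-1 : k) ^ i = -1 := by
  rcases Int.even_or_odd i with hi | hi
  · left; exact hi.neg_one_zpow
  · right; exact hi.neg_one_zpow

theorem sign_add {k : Type*} [Field k] (i j : ℤ) :
    (-1 : k) ^ (i + j) = (-1 : k) ^ i * (-1 : k) ^ j :=
  zpow_add₀ (by simp) i j

/-- The cone bracket built from a bracket and a sign operator. -/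
noncomputable def coneBracket {k V : Type*} [Field k] [AddCommGroup V] [Module k V]
    (B : V →ₗ[k] V →ₗ[k] V) (s : V →ₗ[k] V) : (V × V) →ₗ[k] (V × V) →ₗ[k] (V × V) :=
  LinearMap.mk₂ k (fun X Y => (B (s X.2) Y.1 + B X.1 Y.2, B X.2 Y.2))
    (by intro a b c; ext <;> simp; abel)
    (by intro a b c; ext <;> simp)
    (by intro a b c; ext <;> simp; abel)
    (by intro a b c; ext <;> simp)

/-- Let `g` be a dg Lie algebra over `k` and `h ⊆ g` a dg Lie ideal.  The cone
`C^n := h^{n+1} × g^n` with differential `d_C (x,y) := (−d x, x + d y)` and bracket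
`[(x,y),(x′,y′)] := ((−1)^p [y,x′] + [x,y′], [y,y′])` (for `y ∈ g^p`) is again a dg Lie
algebra: `d_C ∘ d_C = 0` and the bracket satisfies graded skew-symmetry, the graded
Jacobi identity and the graded Leibniz rule with respect to the total grading of `C`. -/
theorem cone_of_dg_lie_ideal_is_dg_lie_algebra
    {k V : Type*} [Field k] [CharZero k] [AddCommGroup V] [Module k V]
    (D : DGLieAlgebra k V)
    (hD : DirectSum.IsInternal fun i : ℤ => D.grading i)
    (h : ℤ → Submodule k V)
    (h_le : ∀ i : ℤ, h i ≤ D.grading i)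
    (h_d : ∀ i : ℤ, ∀ x ∈ h i, D.d x ∈ h (i + 1))
    (h_ideal : ∀ (i j : ℤ), ∀ x ∈ D.grading i, ∀ y ∈ h j, D.bracket x y ∈ h (i + j)) :
    ∃ C : DGLieAlgebra k (V × V),
      (∀ n : ℤ, C.grading n = (h (n + 1)).prod (D.grading n)) ∧
      (∀ x y : V, C.d (x, y) = (-(D.d x), x + D.d y)) ∧
      (∀ (p : ℤ), ∀ x x' : V, ∀ y ∈ D.grading p, ∀ y' : V,
        C.bracket (x, y) (x', y') =
          (((-1 : k) ^ p) • D.bracket y x' + D.bracket x y', D.bracket y y')) := by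
  obtain ⟨s, hs⟩ := exists_sign_map D.grading hD
  refine ⟨{ grading := fun n => (h (n + 1)).prod (D.grading n)
            d := LinearMap.prod (-(D.d ∘ₗ LinearMap.fst k V V))
              (LinearMap.fst k V V + D.d ∘ₗ LinearMap.snd k V V)
            bracket := coneBracket D.bracket s
            d_d := ?_
            d_mem := ?_
            bracket_mem := ?_
            skew := ?_
            jacobi := ?_
            leibniz := ?_ }, ?_, ?_, ?_⟩
  · rintro ⟨x, y⟩
    simp [D.d_d]
  · rintro i ⟨x, y⟩ ⟨hx, hy⟩
    exact ⟨neg_mem (h_d _ _ hx), add_mem (h_le _ hx) (D.d_mem _ _ hy)⟩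
  · rintro i j ⟨x, y⟩ ⟨hx, hy⟩ ⟨x', y'⟩ ⟨hx', hy'⟩
    simp only at hx hy hx' hy'
    refine ⟨?_, D.bracket_mem _ _ _ hy _ hy'⟩
    change D.bracket (s y) x' + D.bracket x y' ∈ h (i + j + 1)
    rw [hs i y hy, D.skew (i + 1) j x (h_le _ hx) y' hy', map_smul, LinearMap.smul_apply]
    have h1 := h_ideal i (j + 1) y hy x' hx'
    have h2 := h_ideal j (i + 1) y' hy' x hx
    rw [show i + (j + 1) = i + j + 1 by ring] at h1
    rw [show j + (i + 1) = i + j + 1 by ring] at h2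
    exact add_mem (Submodule.smul_mem _ _ h1) (neg_mem (Submodule.smul_mem _ _ h2))
  · rintro i j ⟨x, y⟩ ⟨hx, hy⟩ ⟨x', y'⟩ ⟨hx', hy'⟩
    simp only at hx hy hx' hy'
    have h1 := D.skew (i + 1) j x (h_le _ hx) y' hy'
    have h2 := D.skew (j + 1) i x' (h_le _ hx') y hy
    have h3 := D.skew i j y hy y' hy'
    rw [show (i + 1) * j = i * j + j by ring, sign_add] at h1
    rw [show (j + 1) * i = i * j + i by ring, sign_add] at h2
    refine Prod.ext ?_ h3
    change D.bracket (s y) x' + D.bracket x y' =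
      -((-1 : k) ^ (i * j) • (D.bracket (s y') x + D.bracket x' y))
    rw [hs i y hy, hs j y' hy', h1, h2]
    simp only [map_smul, LinearMap.smul_apply]
    rcases sign_cases (k := k) i with ha | ha <;> rcases sign_cases (k := k) j with hb | hb <;>
      rcases sign_cases (k := k) (i * j) with hc | hc <;> rw [ha, hb, hc] <;> module
  · rintro i j ⟨x, y⟩ ⟨hx, hy⟩ ⟨x', y'⟩ ⟨hx', hy'⟩ ⟨x'', y''⟩
    simp only at hx hy hx' hy'
    have h1 := D.jacobi (i + 1) j x (h_le _ hx) y' hy' y''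
    have h2 := D.jacobi i (j + 1) y hy x' (h_le _ hx') y''
    have h3 := D.jacobi i j y hy y' hy' y''
    have h4 := D.jacobi i j y hy y' hy' x''
    rw [show (i + 1) * j = i * j + j by ring, sign_add] at h1
    rw [show i * (j + 1) = i * j + i by ring, sign_add] at h2
    refine Prod.ext ?_ h3
    change D.bracket (s y) (D.bracket (s y') x'' + D.bracket x' y'') +
        D.bracket x (D.bracket y' y'') =
      (D.bracket (s (D.bracket y y')) x'' +
        D.bracket (D.bracket (s y) x' + D.bracket x y') y'') +
      (-1 : k) ^ (i * j) • (D.bracket (s y') (D.bracket (s y) x'' + D.bracket x y'') +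
        D.bracket x' (D.bracket y y''))
    rw [hs i y hy, hs j y' hy', hs (i + j) _ (D.bracket_mem _ _ _ hy _ hy'), sign_add]
    simp only [map_smul, LinearMap.smul_apply, map_add, LinearMap.add_apply]
    rw [h1, h2, h4]
    rcases sign_cases (k := k) i with ha | ha <;> rcases sign_cases (k := k) j with hb | hb <;>
      rcases sign_cases (k := k) (i * j) with hc | hc <;> rw [ha, hb, hc] <;> module
  · rintro i ⟨x, y⟩ ⟨hx, hy⟩ ⟨x', y'⟩
    simp only at hx hy
    have h1 := D.leibniz (i + 1) x (h_le _ hx) y'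
    have h2 := D.leibniz i y hy x'
    have h3 := D.leibniz i y hy y'
    rw [sign_add, zpow_one] at h1
    refine Prod.ext ?_ ?_
    · change -D.d (D.bracket (s y) x' + D.bracket x y') =
        (D.bracket (s (x + D.d y)) x' + D.bracket (-D.d x) y') +
        (-1 : k) ^ i • (D.bracket (s y) (-D.d x') + D.bracket x (x' + D.d y'))
      rw [hs i y hy, hs (i + 1) _ (add_mem (h_le _ hx) (D.d_mem _ _ hy)), sign_add, zpow_one]
      simp only [map_smul, LinearMap.smul_apply, map_add, LinearMap.add_apply, map_neg,
        LinearMap.neg_apply]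
      rw [h1, h2]
      rcases sign_cases (k := k) i with ha | ha <;> rw [ha] <;> module
    · change (D.bracket (s y) x' + D.bracket x y') + D.d (D.bracket y y') =
        D.bracket (x + D.d y) y' + (-1 : k) ^ i • D.bracket y (x' + D.d y')
      rw [hs i y hy, h3]
      simp only [map_smul, LinearMap.smul_apply, map_add, LinearMap.add_apply]
      module
  · intro n
    rfl
  · intro x y
    rfl
  · intro p x x' y hy y'
    change (D.bracket (s y) x' + D.bracket x y', D.bracket y y') = _
    rw [hs p y hy, map_smul, LinearMap.smul_apply]
end

section
/- Let g be a Lie algebra over k and δ the Chevalley boundary operators on the exterior algebra ⋀g (δ(x₁∧⋯∧xₙ) = Σ_{i<j}(−1)^{i+j}[xᵢ,xⱼ]∧x₁∧⋯x̂ᵢ⋯x̂ⱼ⋯∧xₙ, δ = 0 in degrees ≤ 1). For homogeneous a ∈ ⋀ᵖg, b ∈ ⋀^q g define the derived bracket Φ(a,b) := δ(a∧b) − δ(a)∧b − (−1)^p a∧δ(b) ∈ ⋀^{p+q−1} g. Then: (i) for x, y ∈ g one has Φ(x,y) = −[x,y]; and (ii) Φ(a,−) is a graded derivation of the wedge product: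 for homogeneous a ∈ ⋀ᵖg, b ∈ ⋀^q g and c ∈ ⋀g, Φ(a, b∧c) = Φ(a,b) ∧ c + (−1)^{(p−1)q} b ∧ Φ(a,c). -/
open ExteriorAlgebra

/-- The derived bracket `Φ(a,b) := δ(a∧b) − δ(a)∧b − (−1)^p a∧δ(b)` of a degree `−1`
operator `δ` on the exterior algebra, for `a` homogeneous of degree `p`. -/
noncomputable def derivedBracket (k g : Type*) [Field k] [LieRing g] [LieAlgebra k g]
    (δ : ExteriorAlgebra k g →ₗ[k] ExteriorAlgebra k g) (p : ℕ)
    (a b : ExteriorAlgebra k g) : ExteriorAlgebra k g :=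
  δ (a * b) - δ a * b - ((-1 : k) ^ p) • (a * δ b)

/-- `δ` is the Chevalley boundary operator: it maps `⋀ⁿ g` to `⋀^{n−1} g` and satisfies
`δ(x₁∧⋯∧xₙ) = ∑_{i<j} (−1)^{i+j} [xᵢ,xⱼ] ∧ x₁ ∧ ⋯ x̂ᵢ ⋯ x̂ⱼ ⋯ ∧ xₙ`
(in particular `δ = 0` in degrees `≤ 1`). -/
def IsChevalleyBoundary (k g : Type*) [Field k] [LieRing g] [LieAlgebra k g]
    (δ : ExteriorAlgebra k g →ₗ[k] ExteriorAlgebra k g) : Prop :=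
  (∀ n : ℕ, ∀ a ∈ ⋀[k]^n g, δ a ∈ ⋀[k]^(n - 1) g) ∧
  (∀ (n : ℕ) (x : Fin n → g),
    δ (ExteriorAlgebra.ιMulti k n x) =
      ∑ i : Fin n, ∑ j : Fin n,
        if i < j then
          ((-1 : k) ^ ((i : ℕ) + (j : ℕ))) •
            (ExteriorAlgebra.ι k ⁅x i, x j⁆ *
              (((List.finRange n).filter (fun l => l ≠ i ∧ l ≠ j)).map
                (fun l => ExteriorAlgebra.ι k (x l))).prod)
        else 0)

namespace DerivedBracketAux

variable {k g : Type*} [Field k] [LieRing g] [LieAlgebra k g]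

local notation "E" => ExteriorAlgebra k g

/-- Contribution of brackets with `x`. -/
noncomputable def dsum (x : g) (n : ℕ) (v : Fin n → g) : E :=
  ∑ j : Fin n, ((-1 : k) ^ (j : ℕ)) • (ι k ⁅x, v j⁆ *
    (((List.finRange n).filter (fun l => l ≠ j)).map (fun l => ι k (v l))).prod)

/-- The Chevalley sum. -/
noncomputable def bsum (n : ℕ) (x : Fin n → g) : E :=
  ∑ i : Fin n, ∑ j : Fin n,
        if i < j then
          ((-1 : k) ^ ((i : ℕ) + (j : ℕ))) •
            (ExteriorAlgebra.ι k ⁅x i, x j⁆ *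
              (((List.finRange n).filter (fun l => l ≠ i ∧ l ≠ j)).map
                (fun l => ExteriorAlgebra.ι k (x l))).prod)
        else 0

lemma swap (x y : g) : (ι k x : E) * ι k y = -(ι k y * ι k x) :=
  eq_neg_of_add_eq_zero_left (ι_add_mul_swap x y)

lemma prod_finRange (n : ℕ) (v : Fin n → g) :
    ((List.finRange n).map (fun l => (ι k (v l) : E))).prod = ιMulti k n v := by
  rw [ιMulti_apply, List.ofFn_eq_map]

lemma ιMulti_cons (n : ℕ) (x : g) (v : Fin n → g) :
    (ιMulti k (n+1) (Fin.cons x v : Fin (n+1) → g) : E) = ι k x * ιMulti k n v := by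
  rw [ιMulti_succ_apply]; simp [Matrix.vecTail, Function.comp_def]

lemma dsum_cons (x y : g) (n : ℕ) (v : Fin n → g) :
    (dsum x (n+1) (Fin.cons y v : Fin (n+1) → g) : E) =
      ι k ⁅x, y⁆ * ιMulti k n v + ι k y * dsum x n v := by
  unfold dsum
  rw [Fin.sum_univ_succ, Finset.mul_sum]
  congr 1
  · simp [List.finRange_succ, List.filter_map, Function.comp_def, prod_finRange,
      Fin.succ_ne_zero]
  · refine Finset.sum_congr rfl fun j _ => ?_
    have : (0 : Fin (n+1)) ≠ j.succ := (Fin.succ_ne_zero j).symm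
    simp only [List.finRange_succ, List.filter_cons, List.filter_map, Function.comp_def, 
      List.map_map, this, ne_eq, not_false_eq_true, decide_true, if_true, List.map_cons,
      List.prod_cons, Fin.cons_zero, Fin.cons_succ, Fin.succ_inj, Fin.val_succ]
    rw [← mul_assoc, swap, mul_smul_comm, pow_succ, mul_neg_one, neg_smul, neg_mul, smul_neg,
      neg_neg, mul_assoc]

lemma bsum_cons (x : g) (n : ℕ) (v : Fin n → g) :
    (bsum (n+1) (Fin.cons x v : Fin (n+1) → g) : E) =
      - dsum x n v - ι k x * bsum n v := by
  unfold bsum dsum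
  rw [Fin.sum_univ_succ, sub_eq_add_neg, Finset.mul_sum, ← Finset.sum_neg_distrib,
    ← Finset.sum_neg_distrib]
  congr 1
  · rw [Fin.sum_univ_succ]
    simp only [lt_irrefl, if_false, zero_add]
    refine Finset.sum_congr rfl fun j _ => ?_
    simp [List.finRange_succ, List.filter_map, Function.comp_def, pow_succ]
  · refine Finset.sum_congr rfl fun i _ => ?_
    rw [Fin.sum_univ_succ, Finset.mul_sum, ← Finset.sum_neg_distrib]
    simp only [Fin.not_lt_zero, if_false, zero_add]
    refine Finset.sum_congr rfl fun j _ => ?_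
    have h0 : (0 : Fin (n+1)) ≠ j.succ := (Fin.succ_ne_zero j).symm
    have h1 : (0 : Fin (n+1)) ≠ i.succ := (Fin.succ_ne_zero i).symm
    simp only [Fin.succ_lt_succ_iff]
    split_ifs
    · simp only [List.finRange_succ, List.filter_cons, List.filter_map, Function.comp_def, 
        List.map_map, h0, h1, ne_eq, not_false_eq_true, and_self, decide_true, if_true,
        List.map_cons,
        List.prod_cons, Fin.cons_zero, Fin.cons_succ, Fin.succ_inj, Fin.val_succ]
      rw [← mul_assoc, swap, mul_smul_comm, neg_mul, smul_neg, mul_assoc]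
      congr 2
      ring
    · simp

lemma span_ind {P : E → Prop} (h0 : P 0) (hadd : ∀ a b, P a → P b → P (a + b))
    (hs : ∀ (r : k) a, P a → P (r • a)) (n : ℕ) (h : ∀ v : Fin n → g, P (ιMulti k n v))
    (a : E) (ha : a ∈ ⋀[k]^n g) : P a := by
  rw [← ιMulti_span_fixedDegree] at ha
  induction ha using Submodule.span_induction with
  | mem x hx => obtain ⟨v, rfl⟩ := hx; exact h v
  | zero => exact h0
  | add x y _ _ hx hy => exact hadd x y hx hy
  | smul r x _ hx => exact hs r x hx

lemma all_ind {P : E → Prop} (h0 : P 0) (hadd : ∀ a b, P a → P b → P (a + b))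
    (hs : ∀ (r : k) a, P a → P (r • a)) (h : ∀ n (v : Fin n → g), P (ιMulti k n v))
    (a : E) : P a := by
  have ha : a ∈ (⊤ : Submodule k E) := trivial
  rw [← ιMulti_span] at ha
  induction ha using Submodule.span_induction with
  | mem x hx => obtain ⟨v, rfl⟩ := hx; exact h _ _
  | zero => exact h0
  | add x y _ _ hx hy => exact hadd x y hx hy
  | smul r x _ hx => exact hs r x hx

/-- Induction for homogeneous elements. -/
lemma cons_ind {P : ℕ → E → Prop} (h0 : ∀ n, P n 0)
    (hadd : ∀ n a b, P n a → P n b → P n (a + b))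
    (hs : ∀ n (r : k) a, P n a → P n (r • a)) (h1 : P 0 1)
    (hc : ∀ n (x : g) a, a ∈ ⋀[k]^n g → P n a → P (n+1) (ι k x * a))
    (n : ℕ) (a : E) (ha : a ∈ ⋀[k]^n g) : P n a := by
  refine span_ind (h0 n) (hadd n) (hs n) n (fun v => ?_) a ha
  clear ha
  induction n with
  | zero => simpa using h1
  | succ n ih =>
    rw [← Fin.cons_self_tail v, ιMulti_cons]
    refine hc _ _ _ ?_ (ih _)
    rw [← ιMulti_span_fixedDegree]
    exact Submodule.subset_span ⟨_, rfl⟩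

lemma ι_comm (x : g) (q : ℕ) (b : E) (hb : b ∈ ⋀[k]^q g) :
    b * ι k x = (-1 : k) ^ q • (ι k x * b) := by
  refine cons_ind (P := fun q b => b * ι k x = (-1 : k) ^ q • (ι k x * b))
    ?_ ?_ ?_ ?_ ?_ q b hb
  · simp
  · intro n a b ha hb; simp only [add_mul, mul_add, ha, hb, smul_add]
  · intro n r a ha; simp only [smul_mul_assoc, mul_smul_comm, ha]; rw [smul_comm]
  · simp
  · intro n y a _ ha
    rw [mul_assoc, ha, mul_smul_comm, ← mul_assoc, ← mul_assoc, swap y x, pow_succ]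
    simp

lemma comm (q : ℕ) (b : E) (hb : b ∈ ⋀[k]^q g) (p : ℕ) (a : E) (ha : a ∈ ⋀[k]^p g) :
    b * a = (-1 : k) ^ (p * q) • (a * b) := by
  refine cons_ind (P := fun p a => b * a = (-1 : k) ^ (p * q) • (a * b))
    ?_ ?_ ?_ ?_ ?_ p a ha
  · simp
  · intro n a b ha hb; simp only [add_mul, mul_add, ha, hb, smul_add]
  · intro n r a ha; simp only [smul_mul_assoc, mul_smul_comm, ha]; rw [smul_comm]
  · simp
  · intro n y a _ ha
    rw [← mul_assoc, ι_comm y q b hb, smul_mul_assoc, mul_assoc, ha, mul_smul_comm, smul_smul,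
      mul_assoc, ← pow_add]
    congr 2
    ring

variable {δ : ExteriorAlgebra k g →ₗ[k] ExteriorAlgebra k g}

/-- Lie derivative defined from `δ`. -/
noncomputable def lieD (δ : ExteriorAlgebra k g →ₗ[k] ExteriorAlgebra k g) (x : g) (w : E) : E :=
  -(δ (ι k x * w)) - ι k x * δ w

lemma lieD_add (x : g) (v w : E) : lieD δ x (v + w) = lieD δ x v + lieD δ x w := by
  simp only [lieD, mul_add, map_add]; abel

lemma lieD_smul (x : g) (r : k) (w : E) : lieD δ x (r • w) = r • lieD δ x w := by
  simp only [lieD, mul_smul_comm, map_smul, smul_sub, smul_neg]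

lemma lieD_zero (x : g) : lieD δ x (0 : E) = 0 := by simp [lieD]

lemma delta_cons (x : g) (w : E) : δ (ι k x * w) = - (ι k x * δ w) - lieD δ x w := by
  simp only [lieD]; abel

lemma lieD_multi (hδ : IsChevalleyBoundary k g δ) (x : g) (n : ℕ) (v : Fin n → g) :
    lieD δ x (ιMulti k n v) = dsum x n v := by
  have h1 : δ (ιMulti k n v) = bsum n v := hδ.2 n v
  have h2 : δ (ιMulti k (n+1) (Fin.cons x v : Fin (n+1) → g)) = bsum (n+1) (Fin.cons x v) :=
    hδ.2 _ _
  rw [ιMulti_cons, bsum_cons] at h2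
  rw [lieD, h1, h2]; abel

lemma delta_one (hδ : IsChevalleyBoundary k g δ) : δ 1 = 0 := by
  have := hδ.2 0 Fin.elim0
  simpa using this

lemma lieD_one (hδ : IsChevalleyBoundary k g δ) (x : g) : lieD δ x (1 : E) = 0 := by
  have := lieD_multi hδ x 0 Fin.elim0
  simpa [dsum] using this

lemma lieD_cons (hδ : IsChevalleyBoundary k g δ) (x y : g) (w : E) :
    lieD δ x (ι k y * w) = ι k ⁅x, y⁆ * w + ι k y * lieD δ x w := by
  refine all_ind (P := fun w => lieD δ x (ι k y * w) = ι k ⁅x, y⁆ * w + ι k y * lieD δ x w)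
    ?_ ?_ ?_ ?_ w
  · simp [lieD_zero]
  · intro a b ha hb; simp only [mul_add, lieD_add, ha, hb]; abel
  · intro r a ha; simp only [mul_smul_comm, lieD_smul, ha, smul_add]
  · intro n v
    rw [← ιMulti_cons, lieD_multi hδ, lieD_multi hδ, dsum_cons]

lemma lieD_mul (hδ : IsChevalleyBoundary k g δ) (x : g) (q : ℕ) (b : E) (hb : b ∈ ⋀[k]^q g)
    (c : E) : lieD δ x (b * c) = lieD δ x b * c + b * lieD δ x c := by
  refine cons_ind (P := fun _ b => lieD δ x (b * c) = lieD δ x b * c + b * lieD δ x c)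
    ?_ ?_ ?_ ?_ ?_ q b hb
  · simp [lieD_zero]
  · intro _ a b ha hb; simp only [add_mul, lieD_add, ha, hb]; abel
  · intro _ r a ha; simp only [smul_mul_assoc, lieD_smul, ha, smul_add]
  · simp [lieD_one hδ]
  · intro n y a _ ha
    rw [mul_assoc, lieD_cons hδ, lieD_cons hδ, ha]
    simp only [mul_add, add_mul, mul_assoc]; abel

lemma bracket_cons (hδ : IsChevalleyBoundary k g δ) (x : g) (p : ℕ) (a b : E)
    (ha : a ∈ ⋀[k]^p g) :
    derivedBracket k g δ (p+1) (ι k x * a) b =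
      - (ι k x * derivedBracket k g δ p a b) - a * lieD δ x b := by
  unfold derivedBracket
  rw [mul_assoc, delta_cons, delta_cons, lieD_mul hδ x p a ha, pow_succ]
  simp only [mul_sub, sub_mul, mul_smul_comm, mul_assoc, mul_neg_one, neg_smul, neg_mul]
  abel

lemma main (hδ : IsChevalleyBoundary k g δ) (p q : ℕ) (a b c : E) (ha : a ∈ ⋀[k]^p g)
    (hb : b ∈ ⋀[k]^q g) :
    derivedBracket k g δ p a (b * c) = derivedBracket k g δ p a b * c +
          ((-1 : k) ^ (p * q + q)) • (b * derivedBracket k g δ p a c) := by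
  refine cons_ind (P := fun p a => derivedBracket k g δ p a (b * c) =
    derivedBracket k g δ p a b * c +
          ((-1 : k) ^ (p * q + q)) • (b * derivedBracket k g δ p a c)) ?_ ?_ ?_ ?_ ?_ p a ha
  · simp [derivedBracket]
  · intro n a a' h h'
    have e : ∀ d, derivedBracket k g δ n (a + a') d =
        derivedBracket k g δ n a d + derivedBracket k g δ n a' d := by
      intro d; simp only [derivedBracket, add_mul, map_add, smul_add]; abel
    simp only [e, h, h', add_mul, mul_add, smul_add]; abel
  · intro n r a h
    have e : ∀ d, derivedBracket k g δ n (r • a) d = r • derivedBracket k g δ n a d := by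
      intro d
      simp only [derivedBracket, smul_mul_assoc, map_smul, smul_sub]
      rw [smul_comm r]
    simp only [e, h, smul_mul_assoc, mul_smul_comm, smul_add]
    rw [smul_comm r]
  · simp [derivedBracket, delta_one hδ]
  · intro n x a ha h
    simp only [bracket_cons hδ x n a _ ha]
    rw [h, lieD_mul hδ x q b hb]
    have e1 : b * (ι k x * derivedBracket k g δ n a c) =
        (-1 : k) ^ q • (ι k x * (b * derivedBracket k g δ n a c)) := by
      rw [← mul_assoc, ι_comm x q b hb, smul_mul_assoc, mul_assoc]
    have e2 : b * (a * lieD δ x c) = (-1 : k) ^ (n * q) • (a * (b * lieD δ x c)) := by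
      rw [← mul_assoc, comm q b hb n a ha, smul_mul_assoc, mul_assoc]
    have s1 : (-1 : k) ^ ((n + 1) * q + q) * (-1 : k) ^ q = (-1 : k) ^ (n * q + q) := by
      have : ((-1 : k) ^ q) * (-1) ^ q = 1 := by rw [← mul_pow]; simp
      rw [add_mul, one_mul, pow_add, pow_add, mul_assoc, this, mul_one]
    have s2 : (-1 : k) ^ ((n + 1) * q + q) * (-1 : k) ^ (n * q) = 1 := by
      rw [← pow_add]
      exact Even.neg_one_pow ⟨n * q + q, by ring⟩
    rw [mul_sub, mul_neg, e1, e2, smul_sub, smul_neg, smul_smul, smul_smul, s1, s2]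
    simp only [mul_add, sub_mul, neg_mul, mul_assoc, mul_smul_comm, one_smul]
    abel

end DerivedBracketAux

/-- For the Chevalley boundary `δ` on `⋀ g` and the derived bracket
`Φ(a,b) := δ(a∧b) − δ(a)∧b − (−1)^p a∧δ(b)` (for `a ∈ ⋀ᵖ g`, `b ∈ ⋀^q g`):
(i) for `x, y ∈ g` one has `Φ(x,y) = −[x,y]`; and
(ii) `Φ(a,−)` is a graded derivation of the wedge product:
`Φ(a, b∧c) = Φ(a,b) ∧ c + (−1)^{(p−1)q} b ∧ Φ(a,c)`. -/
theorem derived_bracket_on_vectors_and_derivation_property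
    (k g : Type*) [Field k] [CharZero k] [LieRing g] [LieAlgebra k g]
    (δ : ExteriorAlgebra k g →ₗ[k] ExteriorAlgebra k g)
    (hδ : IsChevalleyBoundary k g δ) :
    (∀ x y : g,
      derivedBracket k g δ 1 (ExteriorAlgebra.ι k x) (ExteriorAlgebra.ι k y) =
        -(ExteriorAlgebra.ι k ⁅x, y⁆)) ∧
    (∀ (p q : ℕ) (a b c : ExteriorAlgebra k g), a ∈ ⋀[k]^p g → b ∈ ⋀[k]^q g →
      derivedBracket k g δ p a (b * c) =
        derivedBracket k g δ p a b * c +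
          ((-1 : k) ^ (((p : ℤ) - 1) * (q : ℤ))) • (b * derivedBracket k g δ p a c)) := by
  refine ⟨fun x y => ?_, fun p q a b c ha hb => ?_⟩
  · have h := DerivedBracketAux.bracket_cons hδ x 0 1 (ExteriorAlgebra.ι k y)
      (by simp)
    have h2 := DerivedBracketAux.lieD_cons hδ x y 1
    rw [DerivedBracketAux.lieD_one hδ] at h2
    simp only [mul_one, mul_zero, add_zero] at h2
    simp only [mul_one, one_mul, zero_add, h2] at h
    rw [h]
    simp [derivedBracket, DerivedBracketAux.delta_one hδ]
  · rw [DerivedBracketAux.main hδ p q a b c ha hb]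
    congr 2
    have e : ((p : ℤ) - 1) * q = ((p * q + q : ℕ) : ℤ) + (-2) * q := by push_cast; ring
    rw [e, zpow_add₀ (by simp), zpow_natCast, zpow_mul]
    simp [zpow_neg]
end

section
/- Let σ be a type and S := MvPolynomial σ k. Let Δ : S → S ⊗ S be the unique k-algebra homomorphism with Δ(X_i) = X_i ⊗ 1 + 1 ⊗ X_i for every i ∈ σ, let ε : S → k be the k-algebra homomorphism with ε(X_i) = 0 (evaluation of the constant term), and let π : S → S be π(p) = p − ε(p)·1. For n ≥ 1 let Δ^{(n)} : S → S^{⊗n} be the iterated comultiplication (Δ^{(1)} = id, Δ^{(m+1)} = (Δ ⊗ id^{⊗(m−1)}) ∘ Δ^{(m)}). Then for every p ∈ S and n ≥ 1: π^{⊗n}(Δ^{(n)}(p)) = 0 if and only if the total degree of p is at most n − 1. -/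
open TensorProduct

/-- The iterated tensor power `S^{⊗(m+1)}`, right-nested. -/
noncomputable def TPow (k : Type*) [Field k] (C : Type*) [AddCommGroup C] [Module k C] :
    ℕ → ModuleCat k
  | 0 => ModuleCat.of k C
  | (m + 1) => ModuleCat.of k (C ⊗[k] (TPow k C m))

/-- The iterated comultiplication `Δ^{(m+1)} : S → S^{⊗(m+1)}`, with `Δ^{(1)} = id` and
`Δ^{(m+1)} = (id ⊗ Δ^{(m)}) ∘ Δ` (which, for a coassociative `Δ`, agrees with
`Δ^{(m+1)} = (Δ ⊗ id^{⊗(m−1)}) ∘ Δ^{(m)}`). -/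
noncomputable def iterComul {k : Type*} [Field k] {C : Type*} [AddCommGroup C] [Module k C]
    (Δ : C →ₗ[k] C ⊗[k] C) : (m : ℕ) → (C →ₗ[k] TPow k C m)
  | 0 => LinearMap.id
  | (m + 1) => (LinearMap.lTensor C (iterComul Δ m)).comp Δ

/-- The map `π^{⊗(m+1)} : S^{⊗(m+1)} → S^{⊗(m+1)}` applying `π` in every tensor factor. -/
noncomputable def tensorPowMap {k : Type*} [Field k] {C : Type*} [AddCommGroup C] [Module k C]
    (π : C →ₗ[k] C) : (m : ℕ) → (TPow k C m →ₗ[k] TPow k C m)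
  | 0 => π
  | (m + 1) => TensorProduct.map π (tensorPowMap π m)

namespace PolyCoalg

open MvPolynomial

/-- Product of the factorials of a multi-index, in `k`. -/
noncomputable def fct (k : Type*) [Field k] {σ : Type*} (d : σ →₀ ℕ) : k :=
  d.prod (fun _ n => (n.factorial : k))

theorem fct_ne_zero {k : Type*} [Field k] [CharZero k] {σ : Type*} (d : σ →₀ ℕ) :
    fct k d ≠ 0 := by
  unfold fct Finsupp.prod
  exact Finset.prod_ne_zero_iff.mpr fun i _ => Nat.cast_ne_zero.mpr (Nat.factorial_ne_zero _)

theorem fct_succ {k : Type*} [Field k] {σ : Type*} (d : σ →₀ ℕ) (j : σ) :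
    fct k (d + Finsupp.single j 1) = ((d j + 1 : ℕ) : k) * fct k d := by
  classical
  unfold fct
  rw [Finsupp.prod_of_support_subset (s := insert j d.support) (d + Finsupp.single j 1)
      (by intro x; simp [Finsupp.single_apply]; intro h; by_cases hx : j = x
          · simp [hx]
          · simp_all) _ (by simp),
    Finsupp.prod_of_support_subset (s := insert j d.support) d (by simp) _ (by simp),
    ← Finset.mul_prod_erase _ _ (Finset.mem_insert_self j d.support),
    ← Finset.mul_prod_erase _ (fun x => ((d x).factorial : k))
      (Finset.mem_insert_self j d.support), ← mul_assoc]
  congr 1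
  · simp [Nat.factorial_succ]
  · refine Finset.prod_congr rfl fun x hx => ?_
    have : x ≠ j := (Finset.mem_erase.mp hx).1
    simp [Finsupp.single_apply, this.symm]

/-- Normalized coefficient functional. -/
noncomputable def L (k : Type*) [Field k] {σ : Type*} (d : σ →₀ ℕ) : MvPolynomial σ k →ₗ[k] k :=
  fct k d • lcoeff k d

theorem L_apply {k : Type*} [Field k] {σ : Type*} (d : σ →₀ ℕ) (p : MvPolynomial σ k) :
    L k d p = fct k d * coeff d p := rfl

theorem L_mul_X {k : Type*} [Field k] {σ : Type*} (d : σ →₀ ℕ) (j : σ) (p : MvPolynomial σ k) :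
    L k d (p * X j) = (d j : k) * L k (d - Finsupp.single j 1) p := by
  classical
  rw [L_apply, L_apply, coeff_mul_X']
  by_cases h : d j = 0
  · simp [h]
  · have h1 : d = (d - Finsupp.single j 1) + Finsupp.single j 1 := by
      ext x
      by_cases hx : j = x
      · subst hx; simp; omega
      · simp [Finsupp.single_apply, hx]
    have h2 := fct_succ (k := k) (d - Finsupp.single j 1) j
    rw [← h1] at h2
    have h3 : (d - Finsupp.single j 1 : σ →₀ ℕ) j + 1 = d j := by simp; omega
    rw [h3] at h2
    rw [if_pos (by simpa using h), h2, mul_assoc]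

theorem sub_single_eq {σ : Type*} (d : σ →₀ ℕ) (j : σ) (h : d j ≠ 0) (e : σ →₀ ℕ) :
    (d - Finsupp.single j 1) + e = (d + e) - Finsupp.single j 1 := by
  ext x
  by_cases hx : j = x
  · subst hx; simp; omega
  · simp [Finsupp.single_apply, hx]

/-- Contract the first tensor factor by a functional. -/
noncomputable def ctr {k : Type*} [Field k] {S T : Type*} [AddCommGroup S] [Module k S]
    [AddCommGroup T] [Module k T] (φ : S →ₗ[k] k) : S ⊗[k] T →ₗ[k] T :=
  (TensorProduct.lid k T).toLinearMap ∘ₗ LinearMap.rTensor T φ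

theorem ctr_tmul {k : Type*} [Field k] {S T : Type*} [AddCommGroup S] [Module k S]
    [AddCommGroup T] [Module k T] (φ : S →ₗ[k] k) (s : S) (t : T) :
    ctr φ (s ⊗ₜ[k] t) = φ s • t := by simp [ctr]

theorem ctr_map {k : Type*} [Field k] {S T U : Type*} [AddCommGroup S] [Module k S]
    [AddCommGroup T] [Module k T] [AddCommGroup U] [Module k U]
    (φ : S →ₗ[k] k) (f : S →ₗ[k] S) (g : T →ₗ[k] U) (t : S ⊗[k] T) :
    ctr φ (TensorProduct.map f g t) = g (ctr (φ ∘ₗ f) t) := by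
  induction t with
  | zero => simp
  | tmul x y => simp [ctr_tmul]
  | add x y hx hy => simp [hx, hy]

/-- An element of `k[X] ⊗ T` vanishes iff all its contractions do. -/
theorem eq_zero_iff_ctr {k : Type*} [Field k] {σ : Type*} {T : Type*}
    [AddCommGroup T] [Module k T] (t : MvPolynomial σ k ⊗[k] T) :
    t = 0 ↔ ∀ d, ctr (lcoeff k d) t = 0 := by
  classical
  refine ⟨fun h d => by simp [h], fun h => ?_⟩
  let E := TensorProduct.equivFinsuppOfBasisLeft (N := T) (basisMonomials σ k)
  apply E.injective
  rw [map_zero]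
  ext d
  have key : ∀ t : MvPolynomial σ k ⊗[k] T, E t d = ctr (lcoeff k d) t := by
    intro t
    induction t with
    | zero => simp
    | tmul x y =>
      rw [ctr_tmul]
      simp only [E, TensorProduct.equivFinsuppOfBasisLeft_apply_tmul_apply]
      rfl
    | add x y hx hy => simp [hx, hy]
  rw [key, h]; rfl

section
variable {k : Type*} [Field k] {σ : Type*}
    (Δ : MvPolynomial σ k →ₐ[k] (MvPolynomial σ k ⊗[k] MvPolynomial σ k))
    (hΔ : ∀ i : σ, Δ (MvPolynomial.X i) =
      MvPolynomial.X i ⊗ₜ[k] 1 + 1 ⊗ₜ[k] MvPolynomial.X i)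
include hΔ

theorem ctr_mul_X (d : σ →₀ ℕ) (j : σ) (q : MvPolynomial σ k) :
    ctr (L k d) (Δ (q * X j)) =
      (d j : k) • ctr (L k (d - Finsupp.single j 1)) (Δ q) + ctr (L k d) (Δ q) * X j := by
  rw [map_mul, hΔ]
  generalize Δ q = t
  induction t with
  | zero => simp
  | tmul x y =>
    rw [mul_add, Algebra.TensorProduct.tmul_mul_tmul, Algebra.TensorProduct.tmul_mul_tmul,
      map_add, ctr_tmul, ctr_tmul, ctr_tmul, ctr_tmul, L_mul_X, mul_one, mul_one, mul_smul,
      smul_mul_assoc]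
  | add x y hx hy =>
    rw [add_mul, map_add, hx, hy, map_add, map_add, smul_add, add_mul]; abel

theorem L_ctr (p : MvPolynomial σ k) : ∀ d e : σ →₀ ℕ,
    L k e (ctr (L k d) (Δ p)) = L k (d + e) p := by
  classical
  induction p using MvPolynomial.induction_on with
  | C a =>
    intro d e
    rw [← algebraMap_eq, AlgHom.commutes, Algebra.TensorProduct.algebraMap_apply, ctr_tmul,
      map_smul, smul_eq_mul, L_apply, L_apply, L_apply, algebraMap_eq, coeff_C, coeff_C, coeff_one]
    by_cases hd : d = 0
    · subst hd
      by_cases he : e = 0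
      · subst he; simp [fct]
      · simp [Ne.symm he]
    · have : ¬ (0 = d + e) := by
        intro h
        exact hd (by simpa using (add_eq_zero.mp h.symm).1)
      simp [Ne.symm hd, this]
  | add p q hp hq => intro d e; simp [hp, hq]
  | mul_X p j ih =>
    intro d e
    rw [ctr_mul_X Δ hΔ, map_add, map_smul, L_mul_X, L_mul_X, ih, ih, smul_eq_mul]
    have h1 : (d j : k) * L k (d - Finsupp.single j 1 + e) p =
        (d j : k) * L k (d + e - Finsupp.single j 1) p := by
      by_cases h : d j = 0
      · simp [h]
      · rw [sub_single_eq d j h]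
    have h2 : (e j : k) * L k (d + (e - Finsupp.single j 1)) p =
        (e j : k) * L k (d + e - Finsupp.single j 1) p := by
      by_cases h : e j = 0
      · simp [h]
      · rw [add_comm d, sub_single_eq e j h, add_comm e]
    rw [h1, h2, Finsupp.add_apply, Nat.cast_add, add_mul]

theorem coeff_ctr [CharZero k] (p : MvPolynomial σ k) (d e : σ →₀ ℕ) :
    coeff e (ctr (lcoeff k d) (Δ p)) = 0 ↔ coeff (d + e) p = 0 := by
  have h := L_ctr Δ hΔ p d e
  have h2 : ctr (L k d) (Δ p) = fct k d • ctr (lcoeff k d) (Δ p) := by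
    simp [ctr, L, LinearMap.rTensor_smul]
  rw [h2, L_apply, L_apply, coeff_smul, smul_eq_mul] at h
  have a := fct_ne_zero (k := k) d
  have b := fct_ne_zero (k := k) e
  have c := fct_ne_zero (k := k) (d + e)
  constructor
  · intro h0
    rw [h0] at h
    simpa [c] using h.symm
  · intro h0
    rw [h0] at h
    simpa [a, b] using h

end

theorem totalDegree_le_iff' {k : Type*} [Field k] {σ : Type*} (p : MvPolynomial σ k) (m : ℕ) :
    p.totalDegree ≤ m ↔ ∀ e, coeff e p ≠ 0 → e.degree ≤ m := by
  rw [totalDegree, Finset.sup_le_iff]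
  simp only [mem_support_iff]
  rfl

theorem main {k : Type*} [Field k] [CharZero k] {σ : Type*}
    (Δ : MvPolynomial σ k →ₐ[k] (MvPolynomial σ k ⊗[k] MvPolynomial σ k))
    (hΔ : ∀ i : σ, Δ (MvPolynomial.X i) =
      MvPolynomial.X i ⊗ₜ[k] 1 + 1 ⊗ₜ[k] MvPolynomial.X i)
    (ε : MvPolynomial σ k →ₐ[k] k)
    (hε : ∀ i : σ, ε (MvPolynomial.X i) = 0)
    (π : MvPolynomial σ k →ₗ[k] MvPolynomial σ k)
    (hπ : ∀ p : MvPolynomial σ k, π p = p - algebraMap k (MvPolynomial σ k) (ε p))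
    (m : ℕ) : ∀ p : MvPolynomial σ k,
    tensorPowMap π m (iterComul Δ.toLinearMap m p) = 0 ↔ p.totalDegree ≤ m := by
  classical
  have hε' : ∀ p, ε p = coeff 0 p := by
    intro p
    have : ε = aeval (fun _ => (0 : k)) := by ext i; simp [hε]
    rw [this, ← constantCoeff_eq]
    simp [aeval_zero']
  have hc : ∀ d p, coeff d (π p) = if d = 0 then 0 else coeff d p := by
    intro d p
    rw [hπ, coeff_sub, algebraMap_eq, coeff_C, hε']
    by_cases h : d = 0
    · simp [h]
    · simp [h, Ne.symm h]
  induction m with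
  | zero =>
    intro p
    change π p = 0 ↔ _
    rw [totalDegree_le_iff']
    constructor
    · intro h e he
      have := hc e p
      rw [h, coeff_zero] at this
      by_cases h0 : e = 0
      · simp [h0]
      · rw [if_neg h0] at this
        exact absurd this.symm he
    · intro h
      ext e
      rw [hc, coeff_zero]
      split_ifs with h0
      · rfl
      · by_contra h1
        have := h e h1
        exact h0 ((Finsupp.degree_eq_zero_iff e).mp (by omega))
  | succ m ih =>
    intro p
    have e1 : tensorPowMap π (m + 1) (iterComul Δ.toLinearMap (m + 1) p) =
        TensorProduct.map π ((tensorPowMap π m) ∘ₗ (iterComul Δ.toLinearMap m)) (Δ p) := by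
      change TensorProduct.map π (tensorPowMap π m)
        (LinearMap.lTensor _ (iterComul Δ.toLinearMap m) (Δ p)) = _
      generalize Δ p = t
      induction t with
      | zero => simp
      | tmul x y => simp
      | add x y hx hy => simp only [map_add, hx, hy]
    have e2 : TensorProduct.map π ((tensorPowMap π m) ∘ₗ (iterComul Δ.toLinearMap m)) (Δ p) = 0 ↔
        p.totalDegree ≤ m + 1 := by
      rw [eq_zero_iff_ctr, totalDegree_le_iff']
      have e3 : ∀ d, ctr (lcoeff k d)
          (TensorProduct.map π ((tensorPowMap π m) ∘ₗ (iterComul Δ.toLinearMap m)) (Δ p)) = 0 ↔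
          (d ≠ 0 → ∀ e, coeff (d + e) p ≠ 0 → e.degree ≤ m) := by
        intro d
        rw [ctr_map, LinearMap.comp_apply, ih, totalDegree_le_iff']
        by_cases hd : d = 0
        · have : lcoeff k d ∘ₗ π = 0 := by
            apply LinearMap.ext
            intro q
            exact (hc d q).trans (if_pos hd)
          rw [this]
          simp [hd, ctr]
        · have : lcoeff k d ∘ₗ π = lcoeff k d := by
            apply LinearMap.ext
            intro q
            exact (hc d q).trans (if_neg hd)
          rw [this]
          simp only [ne_eq, coeff_ctr Δ hΔ, hd, not_false_eq_true, forall_const]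
      simp only [e3]
      constructor
      · intro h f hf
        by_cases h0 : f = 0
        · simp [h0]
        · obtain ⟨i, hi⟩ := Finsupp.ne_iff.mp h0
          have hfe : Finsupp.single i 1 + (f - Finsupp.single i 1) = f :=
            add_tsub_cancel_of_le (by
              rw [Finsupp.single_le_iff]; exact Nat.one_le_iff_ne_zero.mpr hi)
          have := h (Finsupp.single i 1) (by simp) (f - Finsupp.single i 1) (by rwa [hfe])
          rw [← hfe, map_add, Finsupp.degree_single]
          omega
      · intro h d hd e he
        have := h _ he
        rw [map_add] at this
        have h1 : d.degree ≠ 0 := fun h => hd ((Finsupp.degree_eq_zero_iff d).mp h)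
        omega
    exact (Eq.congr_left e1).trans e2

end PolyCoalg

/-- Let `S = k[Xᵢ : i ∈ σ]`, let `Δ : S → S ⊗ S` be the `k`-algebra homomorphism with
`Δ(Xᵢ) = Xᵢ ⊗ 1 + 1 ⊗ Xᵢ`, let `ε : S → k` be the `k`-algebra homomorphism with
`ε(Xᵢ) = 0`, and let `π(p) = p − ε(p)·1`.  Then for every `p ∈ S` and `n ≥ 1`:
`π^{⊗n}(Δ^{(n)}(p)) = 0` if and only if the total degree of `p` is at most `n − 1`. -/
theorem polynomial_coalgebra_filtration_eq_degree_filtration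
    {k : Type*} [Field k] [CharZero k] {σ : Type*}
    (Δ : MvPolynomial σ k →ₐ[k] (MvPolynomial σ k ⊗[k] MvPolynomial σ k))
    (hΔ : ∀ i : σ, Δ (MvPolynomial.X i) =
      MvPolynomial.X i ⊗ₜ[k] 1 + 1 ⊗ₜ[k] MvPolynomial.X i)
    (ε : MvPolynomial σ k →ₐ[k] k)
    (hε : ∀ i : σ, ε (MvPolynomial.X i) = 0)
    (π : MvPolynomial σ k →ₗ[k] MvPolynomial σ k)
    (hπ : ∀ p : MvPolynomial σ k, π p = p - algebraMap k (MvPolynomial σ k) (ε p))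
    (n : ℕ) (hn : 1 ≤ n) (p : MvPolynomial σ k) :
    tensorPowMap π (n - 1) (iterComul Δ.toLinearMap (n - 1) p) = 0 ↔
      p.totalDegree ≤ n - 1 := by
  exact PolyCoalg.main Δ hΔ ε hε π hπ (n - 1) p
end
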